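/- arXiv:1106.5369 — 2 statements merged into one kernel-verified Lean document; each statement's English description precedes it below -/
import Mathlib

section
/- Semigroup (splitting) property of the resolvent: let v be absolutely continuous on [0,1] such that the sets {v_x > 0} and {v_x < 0} are open with finitely many connected components, and let h₁, h₂ > 0. If u¹ minimizes J_{h₁,v}(u) = h₁∫|u_x| + (1/2)∫(u-v)² and u² minimizes J_{h₂,u¹}(u) = h₂∫|u_x| + (1/2)∫(u-u¹)², then u² minimizes J_{h,v} with h = h₁ + h₂. -/
open MeasureTheory Set

namespace TVaux

/-- Real-valued variation on `[a,b]`. -/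
noncomputable def V (g : ℝ → ℝ) (a b : ℝ) : ℝ := (eVariationOn g (Icc a b)).toReal

lemma V_nonneg (g : ℝ → ℝ) (a b : ℝ) : 0 ≤ V g a b := ENNReal.toReal_nonneg

lemma V_self (g : ℝ → ℝ) (a : ℝ) : V g a a = 0 := by
  unfold V
  rw [eVariationOn.subsingleton g (by simp)]; simp

lemma eV_add (g : ℝ → ℝ) {a b c : ℝ} (hab : a ≤ b) (hbc : b ≤ c) :
    eVariationOn g (Icc a b) + eVariationOn g (Icc b c) = eVariationOn g (Icc a c) := by
  have := eVariationOn.Icc_add_Icc g (s := univ) hab hbc (mem_univ b)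
  simpa using this

lemma V_add {g : ℝ → ℝ} {a b c : ℝ} (hg : BoundedVariationOn g (Icc a c)) (hab : a ≤ b)
    (hbc : b ≤ c) : V g a b + V g b c = V g a c := by
  unfold V
  rw [← eV_add g hab hbc, ENNReal.toReal_add]
  · exact hg.mono (Icc_subset_Icc le_rfl hbc)
  · exact hg.mono (Icc_subset_Icc hab le_rfl)

lemma abs_le_V {g : ℝ → ℝ} {x y : ℝ} (hg : BoundedVariationOn g (Icc x y)) (hxy : x ≤ y) :
    |g y - g x| ≤ V g x y := by
  have := hg.dist_le (right_mem_Icc.2 hxy) (left_mem_Icc.2 hxy)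
  rwa [Real.dist_eq] at this

lemma eV_le {g G : ℝ → ℝ} {a b : ℝ} (hab : a ≤ b)
    (h : ∀ x y, a ≤ x → x ≤ y → y ≤ b → |g y - g x| ≤ G y - G x) :
    eVariationOn g (Icc a b) ≤ ENNReal.ofReal (G b - G a) := by
  have hG : MonotoneOn G (Icc a b) := by
    intro x hx y hy hxy
    have := h x y hx.1 hxy hy.2
    have := abs_nonneg (g y - g x)
    linarith
  have h1 := hG.eVariationOn_le (left_mem_Icc.2 hab) (right_mem_Icc.2 hab)
  rw [inter_self] at h1
  refine le_trans ?_ h1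
  refine iSup_le ?_
  rintro ⟨n, u, hu, us⟩
  refine le_trans (Finset.sum_le_sum fun i _ => ?_) (eVariationOn.sum_le hu us (n := n))
  rw [edist_dist, edist_dist, Real.dist_eq, Real.dist_eq]
  apply ENNReal.ofReal_le_ofReal
  exact (h _ _ (us i).1 (hu (Nat.le_succ i)) (us (i+1)).2).trans (le_abs_self _)

lemma bv_of_le {g G : ℝ → ℝ} {a b : ℝ} (hab : a ≤ b)
    (h : ∀ x y, a ≤ x → x ≤ y → y ≤ b → |g y - g x| ≤ G y - G x) :
    BoundedVariationOn g (Icc a b) :=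
  ne_top_of_le_ne_top ENNReal.ofReal_ne_top (eV_le hab h)

lemma V_le {g G : ℝ → ℝ} {a b : ℝ} (hab : a ≤ b)
    (h : ∀ x y, a ≤ x → x ≤ y → y ≤ b → |g y - g x| ≤ G y - G x) :
    V g a b ≤ G b - G a := by
  have h0 : 0 ≤ G b - G a := (abs_nonneg _).trans (h a b le_rfl hab le_rfl)
  exact ENNReal.toReal_le_of_le_ofReal h0 (eV_le hab h)

lemma V_diff {g : ℝ → ℝ} {a b x y : ℝ} (hg : BoundedVariationOn g (Icc a b)) (hax : a ≤ x)
    (hxy : x ≤ y) (hyb : y ≤ b) : V g x y = V g a y - V g a x := by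
  have := V_add (hg.mono (Icc_subset_Icc le_rfl hyb)) hax hxy
  linarith

lemma bv_split {g p q : ℝ → ℝ} {a b : ℝ} (hab : a ≤ b) (hg : BoundedVariationOn g (Icc a b))
    (h : ∀ x y, a ≤ x → x ≤ y → y ≤ b → |p y - p x| + |q y - q x| ≤ V g x y) :
    BoundedVariationOn p (Icc a b) ∧ BoundedVariationOn q (Icc a b) ∧
      V p a b + V q a b ≤ V g a b := by
  have hp : BoundedVariationOn p (Icc a b) := by
    refine bv_of_le (G := fun x => V g a x) hab fun x y h1 h2 h3 => ?_
    have := h x y h1 h2 h3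
    rw [V_diff hg h1 h2 h3] at this
    have := abs_nonneg (q y - q x)
    linarith
  have hq : BoundedVariationOn q (Icc a b) := by
    refine bv_of_le (G := fun x => V g a x) hab fun x y h1 h2 h3 => ?_
    have := h x y h1 h2 h3
    rw [V_diff hg h1 h2 h3] at this
    have := abs_nonneg (p y - p x)
    linarith
  refine ⟨hp, hq, ?_⟩
  -- first the variation of q on subintervals
  have key : ∀ x y, a ≤ x → x ≤ y → y ≤ b → |p y - p x| + V q x y ≤ V g x y := by
    intro x y h1 h2 h3
    have e1 : V q x y ≤ (V g a y - p y) - (V g a x - p x) := by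
      refine V_le (G := fun z => V g a z - p z) h2 fun x' y' h1' h2' h3' => ?_
      have := h x' y' (h1.trans h1') h2' (h3'.trans h3)
      rw [V_diff hg (h1.trans h1') h2' (h3'.trans h3)] at this
      have := le_abs_self (p y' - p x')
      linarith
    have e2 : V q x y ≤ (V g a y + p y) - (V g a x + p x) := by
      refine V_le (G := fun z => V g a z + p z) h2 fun x' y' h1' h2' h3' => ?_
      have := h x' y' (h1.trans h1') h2' (h3'.trans h3)
      rw [V_diff hg (h1.trans h1') h2' (h3'.trans h3)] at this
      have := neg_abs_le (p y' - p x')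
      linarith
    rw [V_diff hg h1 h2 h3]
    rcases abs_cases (p y - p x) with h | h <;> linarith
  have := V_le (g := p) (G := fun z => V g a z - V q a z) hab fun x y h1 h2 h3 => by
    have := key x y h1 h2 h3
    rw [V_diff hg h1 h2 h3, V_diff hq h1 h2 h3] at this
    linarith
  simp only [V_self] at this
  linarith

/-- Measurable and bounded on `[0,1]`. -/
def Nice (g : ℝ → ℝ) : Prop :=
  AEStronglyMeasurable g (volume.restrict (Ioc (0 : ℝ) 1)) ∧
    ∃ C, ∀ x ∈ Icc (0 : ℝ) 1, |g x| ≤ C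

lemma Nice.add {f g : ℝ → ℝ} (hf : Nice f) (hg : Nice g) : Nice (fun x => f x + g x) := by
  obtain ⟨hf, C, hC⟩ := hf
  obtain ⟨hg, D, hD⟩ := hg
  exact ⟨hf.add hg, C + D, fun x hx => (abs_add_le _ _).trans (add_le_add (hC x hx) (hD x hx))⟩

lemma Nice.mul {f g : ℝ → ℝ} (hf : Nice f) (hg : Nice g) : Nice (fun x => f x * g x) := by
  obtain ⟨hf, C, hC⟩ := hf
  obtain ⟨hg, D, hD⟩ := hg
  refine ⟨hf.mul hg, C * D, fun x hx => ?_⟩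
  rw [abs_mul]
  exact mul_le_mul (hC x hx) (hD x hx) (abs_nonneg _) ((abs_nonneg _).trans (hC x hx))

lemma Nice.const (c : ℝ) : Nice (fun _ => c) :=
  ⟨aestronglyMeasurable_const, |c|, fun _ _ => le_rfl⟩

lemma Nice.neg {f : ℝ → ℝ} (hf : Nice f) : Nice (fun x => - f x) := by
  obtain ⟨hf, C, hC⟩ := hf
  exact ⟨hf.neg, C, fun x hx => by rw [abs_neg]; exact hC x hx⟩

lemma Nice.sub {f g : ℝ → ℝ} (hf : Nice f) (hg : Nice g) : Nice (fun x => f x - g x) := by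
  simpa [sub_eq_add_neg] using hf.add hg.neg

lemma Nice.sq {f : ℝ → ℝ} (hf : Nice f) : Nice (fun x => f x ^ 2) := by
  simpa [pow_two] using hf.mul hf

lemma Nice.int {f : ℝ → ℝ} (hf : Nice f) : IntervalIntegrable f volume 0 1 := by
  obtain ⟨hf, C, hC⟩ := hf
  rw [intervalIntegrable_iff_integrableOn_Ioc_of_le zero_le_one]
  refine Integrable.of_bound hf C ?_
  filter_upwards [ae_restrict_mem measurableSet_Ioc] with x hx
  exact hC x ⟨hx.1.le, hx.2⟩

lemma Nice.of_cont {f : ℝ → ℝ} (hf : ContinuousOn f (Icc (0 : ℝ) 1)) : Nice f := by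
  refine ⟨(hf.mono Ioc_subset_Icc_self).aestronglyMeasurable measurableSet_Ioc, ?_⟩
  exact isCompact_Icc.exists_bound_of_continuousOn hf

lemma Nice.of_bv {f : ℝ → ℝ} (hf : BoundedVariationOn f (Icc (0 : ℝ) 1)) : Nice f := by
  constructor
  · obtain ⟨p, q, hp, hq, rfl⟩ := hf.locallyBoundedVariationOn.exists_monotoneOn_sub_monotoneOn
    have h1 : IntervalIntegrable p volume 0 1 :=
      MonotoneOn.intervalIntegrable (by rwa [uIcc_of_le zero_le_one])
    have h2 : IntervalIntegrable q volume 0 1 :=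
      MonotoneOn.intervalIntegrable (by rwa [uIcc_of_le zero_le_one])
    exact (h1.sub h2).1.aestronglyMeasurable
  · refine ⟨|f 0| + V f 0 1, fun x hx => ?_⟩
    have := hf.dist_le hx (left_mem_Icc.2 zero_le_one)
    rw [Real.dist_eq] at this
    have h3 : |f x| ≤ |f x - f 0| + |f 0| := by
      simpa using abs_add_le (f x - f 0) (f 0)
    unfold V; linarith

/-- minimizer -/
structure IsMin (h : ℝ) (f u : ℝ → ℝ) : Prop where
  bv : BoundedVariationOn u (Icc (0 : ℝ) 1)
  left : u 0 = f 0
  right : u 1 = f 1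
  minim : ∀ w : ℝ → ℝ, BoundedVariationOn w (Icc (0 : ℝ) 1) → w 0 = f 0 → w 1 = f 1 →
      h * V u 0 1 + (1 / 2) * ∫ x in (0 : ℝ)..1, (u x - f x) ^ 2
        ≤ h * V w 0 1 + (1 / 2) * ∫ x in (0 : ℝ)..1, (w x - f x) ^ 2

lemma eV_neg (u : ℝ → ℝ) (s : Set ℝ) : eVariationOn (fun x => - u x) s = eVariationOn u s := by
  unfold eVariationOn
  simp [edist_neg_neg]

lemma IsMin.neg {h : ℝ} {f u : ℝ → ℝ} (H : IsMin h f u) :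
    IsMin h (fun x => - f x) (fun x => - u x) := by
  refine ⟨?_, by simp [H.left], by simp [H.right], fun w hw h0 h1 => ?_⟩
  · have := H.bv
    unfold BoundedVariationOn at this ⊢
    rwa [eV_neg]
  · have := H.minim (fun x => - w x) (by unfold BoundedVariationOn at hw ⊢; rwa [eV_neg])
      (by simp [h0]) (by simp [h1])
    unfold V at this ⊢
    rw [eV_neg] at this ⊢
    have e1 : ∀ x, (-u x - -f x) ^ 2 = (u x - f x) ^ 2 := fun x => by ring
    have e2 : ∀ x, (-w x - f x) ^ 2 = (w x - -f x) ^ 2 := fun x => by ring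
    simp only [e1, e2] at this ⊢
    exact this

open Classical in
/-- competitor -/
noncomputable def comp (u : ℝ → ℝ) (p q L : ℝ) : ℝ → ℝ :=
  fun x => if p < x ∧ x < q then max (u x) L else u x

lemma max_min_abs (a b L : ℝ) : |max a L - max b L| + |min a L - min b L| = |a - b| := by
  rcases le_total a L with h1 | h1 <;> rcases le_total b L with h2 | h2 <;>
    simp only [max_eq_left, max_eq_right, min_eq_left, min_eq_right, h1, h2, sub_self, abs_zero,
      zero_add, add_zero]
  · rw [abs_of_nonpos (by linarith), abs_of_nonpos (by linarith), abs_of_nonpos (by linarith)]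
    ring
  · rw [abs_of_nonneg (by linarith), abs_of_nonneg (by linarith), abs_of_nonneg (by linarith)]
    ring

lemma comp_var {u : ℝ → ℝ} {p q L : ℝ} (hp : 0 ≤ p) (hpq : p < q) (hq : q ≤ 1)
    (hu : BoundedVariationOn u (Icc (0 : ℝ) 1)) :
    BoundedVariationOn (comp u p q L) (Icc (0 : ℝ) 1) ∧
    BoundedVariationOn (fun x => min (u x) L) (Icc p q) ∧
    V (comp u p q L) 0 1 + V (fun x => min (u x) L) p q ≤
      V u 0 1 + max (L - u p) 0 + max (L - u q) 0 := by
  have hu' : BoundedVariationOn u (Icc p q) := hu.mono (Icc_subset_Icc hp hq)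
  obtain ⟨hM, hm, hMm⟩ := bv_split (p := fun x => max (u x) L) (q := fun x => min (u x) L)
    hpq.le hu' (fun x y h1 h2 h3 => by
      rw [max_min_abs]
      exact abs_le_V (hu'.mono (Icc_subset_Icc h1 h3)) h2)
  set M : ℝ → ℝ := fun x => max (u x) L with hMdef
  set G : ℝ → ℝ := fun x => V M p x + (if x = p then 0 else max (L - u p) 0) +
    (if x = q then max (L - u q) 0 else 0) with hG
  have hcomp : ∀ x y, p ≤ x → x ≤ y → y ≤ q →
      |comp u p q L y - comp u p q L x| ≤ G y - G x := by
    intro x y h1 h2 h3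
    rcases h2.eq_or_lt with rfl | h2
    · simp
    have hA : |M y - M x| ≤ V M p y - V M p x := by
      rw [← V_diff hM h1 h2.le h3]
      exact abs_le_V (hM.mono (Icc_subset_Icc h1 h3)) h2.le
    have hB : |comp u p q L x - M x| ≤ if x = p then max (L - u p) 0 else 0 := by
      split_ifs with hx
      · subst hx
        simp only [comp, hMdef, lt_irrefl, false_and, if_false]
        rw [abs_sub_comm, ← max_sub_sub_right, sub_self, max_comm, abs_of_nonneg (le_max_right _ _)]
      · have : p < x ∧ x < q := ⟨lt_of_le_of_ne h1 (Ne.symm hx), by linarith⟩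
        simp [comp, hMdef, this]
    have hC : |comp u p q L y - M y| ≤ if y = q then max (L - u q) 0 else 0 := by
      split_ifs with hx
      · subst hx
        simp only [comp, hMdef, lt_irrefl, and_false, if_false]
        rw [abs_sub_comm, ← max_sub_sub_right, sub_self, max_comm, abs_of_nonneg (le_max_right _ _)]
      · have : p < y ∧ y < q := ⟨by linarith, lt_of_le_of_ne h3 hx⟩
        simp [comp, hMdef, this]
    have hyp : y ≠ p := by linarith [h1, h2] |> fun (h : p < y) => h.ne'
    have hxq : x ≠ q := by linarith [h1, h2] |> fun (h : x < q) => h.ne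
    have hD : |comp u p q L y - comp u p q L x| ≤
        |comp u p q L y - M y| + |M y - M x| + |comp u p q L x - M x| := by
      rw [abs_sub_comm (comp u p q L x)]
      have e : comp u p q L y - comp u p q L x = (comp u p q L y - M y) + (M y - M x) +
        (M x - comp u p q L x) := by ring
      rw [e]
      exact abs_add_three _ _ _
    simp only [hG, hyp, hxq, if_false]
    split_ifs at hB hC ⊢ <;> linarith
  have hw : BoundedVariationOn (comp u p q L) (Icc p q) := bv_of_le hpq.le hcomp
  have hVw := V_le hpq.le hcomp
  simp only [hG, V_self, hpq.ne', hpq.ne, if_true, if_false] at hVw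
  have e1 : eVariationOn (comp u p q L) (Icc 0 p) = eVariationOn u (Icc 0 p) :=
    eVariationOn.congr fun x hx => by
      simp [comp, not_lt.2 hx.2]
  have e2 : eVariationOn (comp u p q L) (Icc q 1) = eVariationOn u (Icc q 1) :=
    eVariationOn.congr fun x hx => by
      simp [comp, not_lt.2 hx.1]
  have hW : BoundedVariationOn (comp u p q L) (Icc (0 : ℝ) 1) := by
    unfold BoundedVariationOn
    rw [← eV_add _ hp (hpq.le.trans hq), ← eV_add _ hpq.le hq, e1, e2]
    refine ENNReal.add_ne_top.2 ⟨hu.mono (Icc_subset_Icc le_rfl (hpq.le.trans hq)),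
      ENNReal.add_ne_top.2 ⟨hw, hu.mono (Icc_subset_Icc (hp.trans hpq.le) le_rfl)⟩⟩
  refine ⟨hW, hm, ?_⟩
  have a1 := V_add hW hp (hpq.le.trans hq)
  have a2 := V_add (hW.mono (Icc_subset_Icc hp le_rfl)) hpq.le hq
  have b1 := V_add hu hp (hpq.le.trans hq)
  have b2 := V_add (hu.mono (Icc_subset_Icc hp le_rfl)) hpq.le hq
  have c1 : V (comp u p q L) 0 p = V u 0 p := by unfold V; rw [e1]
  have c2 : V (comp u p q L) q 1 = V u q 1 := by unfold V; rw [e2]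
  linarith

lemma comp_sq {u f : ℝ → ℝ} {p q L : ℝ} (hf : ∀ x, p < x → x < q → L ≤ f x) (x : ℝ) :
    (comp u p q L x - f x) ^ 2 ≤ (u x - f x) ^ 2 := by
  unfold comp
  split_ifs with hx
  · have := hf x hx.1 hx.2
    rcases le_total (u x) L with h | h
    · rw [max_eq_right h]; nlinarith
    · rw [max_eq_left h]
  · exact le_rfl

lemma int_le {f g : ℝ → ℝ} (hf : Nice f) (hg : Nice g) (h : ∀ x, f x ≤ g x) :
    ∫ x in (0 : ℝ)..1, f x ≤ ∫ x in (0 : ℝ)..1, g x :=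
  intervalIntegral.integral_mono zero_le_one hf.int hg.int h

/-- strong form: both endpoints above `L` -/
lemma IsMin.above {h : ℝ} (hh : 0 < h) {f u : ℝ → ℝ} (H : IsMin h f u) (hfn : Nice f)
    {p q L : ℝ} (hp : 0 ≤ p) (hpq : p < q) (hq : q ≤ 1)
    (hf : ∀ x, p < x → x < q → L ≤ f x) (h1 : L ≤ u p) (h2 : L ≤ u q)
    {y : ℝ} (hy : y ∈ Icc p q) : L ≤ u y := by
  obtain ⟨hW, hm, hV⟩ := comp_var (L := L) hp hpq hq H.bv
  have hmin := H.minim _ hW (by simp [comp, not_lt.2 hp, H.left]) (by simp [comp, not_lt.2 hq, H.right])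
  have hint := int_le ((Nice.of_bv hW).sub hfn).sq ((Nice.of_bv H.bv).sub hfn).sq (comp_sq hf)
  rw [max_eq_right (by linarith), max_eq_right (by linarith)] at hV
  have hm0 : V (fun x => min (u x) L) p q ≤ 0 := by
    by_contra hc
    push Not at hc
    nlinarith
  have hd := hm.dist_le hy (left_mem_Icc.2 hpq.le)
  have : dist (min (u y) L) (min (u p) L) ≤ 0 := hd.trans hm0
  have := dist_le_zero.1 this
  rw [min_eq_right h1] at this
  exact min_eq_right_iff.1 this

/-- weak form: one endpoint above `L` -/
lemma IsMin.above_ae {h : ℝ} (hh : 0 < h) {f u : ℝ → ℝ} (H : IsMin h f u) (hfn : Nice f)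
    {p q L : ℝ} (hp : 0 ≤ p) (hpq : p < q) (hq : q ≤ 1)
    (hf : ∀ x, p < x → x < q → L ≤ f x) (h1 : L ≤ u p ∨ L ≤ u q)
    {r s : ℝ} (hr : p ≤ r) (hrs : r < s) (hs : s ≤ q) : ∃ y, r < y ∧ y < s ∧ L ≤ u y := by
  obtain ⟨hW, hm, hV⟩ := comp_var (L := L) hp hpq hq H.bv
  have hmin := H.minim _ hW (by simp [comp, not_lt.2 hp, H.left]) (by simp [comp, not_lt.2 hq, H.right])
  have hn1 := ((Nice.of_bv hW).sub hfn).sq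
  have hn2 := ((Nice.of_bv H.bv).sub hfn).sq
  have hb : V (comp u p q L) 0 1 ≤ V u 0 1 := by
    have := abs_le_V hm hpq.le
    have h3 : max (L - u p) 0 + max (L - u q) 0 ≤ |min (u q) L - min (u p) L| := by
      rcases h1 with h1 | h1
      · rw [max_eq_right (by linarith : L - u p ≤ 0), min_eq_right h1, zero_add]
        rcases le_total (u q) L with h | h
        · rw [max_eq_left (by linarith), min_eq_left h, abs_sub_comm]; exact le_abs_self _
        · rw [max_eq_right (by linarith)]; positivity
      · rw [max_eq_right (by linarith : L - u q ≤ 0), min_eq_right h1, add_zero]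
        rcases le_total (u p) L with h | h
        · rw [max_eq_left (by linarith), min_eq_left h]; exact le_abs_self _
        · rw [max_eq_right (by linarith)]; positivity
    linarith
  by_contra hc
  push Not at hc
  -- strict inequality of integrals
  have hlt : ∫ x in (0 : ℝ)..1, (comp u p q L x - f x) ^ 2 < ∫ x in (0 : ℝ)..1, (u x - f x) ^ 2 := by
    refine intervalIntegral.integral_lt_integral_of_ae_le_of_measure_setOf_lt_ne_zero zero_le_one
      hn1.int hn2.int (Filter.Eventually.of_forall (comp_sq hf)) ?_
    have hsub : Ioo r s ⊆ {x | (comp u p q L x - f x) ^ 2 < (u x - f x) ^ 2} := by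
      intro x hx
      have hu := hc x hx.1 hx.2
      have hx' : p < x ∧ x < q := ⟨by linarith [hx.1], by linarith [hx.2]⟩
      have := hf x hx'.1 hx'.2
      simp only [mem_setOf_eq, comp, hx', and_self, if_true, max_eq_right hu.le]
      nlinarith
    have : Ioo r s ⊆ {x | (comp u p q L x - f x) ^ 2 < (u x - f x) ^ 2} ∩ Ioc 0 1 :=
      fun x hx => ⟨hsub hx, by linarith [hx.1], by linarith [hx.2]⟩
    intro h0
    have hle : volume (Ioo r s) ≤ 0 := by
      rw [← h0]
      exact (measure_mono this).trans (Measure.le_restrict_apply _ _)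
    rw [Real.volume_Ioo] at hle
    simp at hle
    linarith
  nlinarith

lemma IsMin.N {h : ℝ} (hh : 0 < h) {f u : ℝ → ℝ} (H : IsMin h f u) (hfn : Nice f)
    {a b L : ℝ} (hf : ∀ x, 0 ≤ x → x ≤ 1 → a < x → x < b → L ≤ f x)
    {x y : ℝ} (hx : 0 ≤ x) (hx1 : x ≤ 1) (hax : a < x) (hxb : x < b)
    (hy : 0 ≤ y) (hy1 : y ≤ 1) (hay : a < y) (hyb : y < b)
    (hLx : L ≤ u x) : L ≤ u y := by
  rcases hy.eq_or_lt with rfl | hy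
  · rw [H.left]; exact hf 0 le_rfl hy1 hay hyb
  rcases hy1.eq_or_lt with rfl | hy1
  · rw [H.right]; exact hf 1 hy.le le_rfl hay hyb
  obtain ⟨p, hap, hp0, hpy, hLp⟩ : ∃ p, a < p ∧ 0 ≤ p ∧ p < y ∧ L ≤ u p := by
    rcases lt_or_ge x y with hxy | hxy
    · exact ⟨x, hax, hx, hxy, hLx⟩
    · obtain ⟨z, hz1, hz2⟩ := exists_between (max_lt hay hy)
      have hz3 := (le_max_left _ _).trans_lt hz1
      have hz4 := (le_max_right _ _).trans_lt hz1
      obtain ⟨p, hp1, hp2, hp3⟩ := H.above_ae hh hfn (p := z) (q := x) (L := L) hz4.le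
        (by linarith) hx1 (fun t h1 h2 => hf t (by linarith) (by linarith) (by linarith)
          (by linarith)) (Or.inr hLx) le_rfl hz2 hxy
      exact ⟨p, by linarith, by linarith, hp2, hp3⟩
  obtain ⟨q, hqb, hq1, hyq, hLq⟩ : ∃ q, q < b ∧ q ≤ 1 ∧ y < q ∧ L ≤ u q := by
    rcases lt_or_ge y x with hxy | hxy
    · exact ⟨x, hxb, hx1, hxy, hLx⟩
    · obtain ⟨z, hz1, hz2⟩ := exists_between (lt_min hyb hy1)
      have hz3 := hz2.trans_le (min_le_left _ _)
      have hz4 := hz2.trans_le (min_le_right _ _)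
      obtain ⟨p, hp1, hp2, hp3⟩ := H.above_ae hh hfn (p := x) (q := z) (L := L) hx
        (by linarith) hz4.le (fun t h1 h2 => hf t (by linarith) (by linarith) (by linarith)
          (by linarith)) (Or.inl hLx) hxy hz1 le_rfl
      exact ⟨p, by linarith, by linarith, hp1, hp3⟩
  exact H.above hh hfn hp0 (hpy.trans hyq) hq1 (fun t h1 h2 => hf t (by linarith) (by linarith)
    (by linarith) (by linarith)) hLp hLq ⟨hpy.le, hyq.le⟩

lemma IsMin.N' {h : ℝ} (hh : 0 < h) {f u : ℝ → ℝ} (H : IsMin h f u) (hfn : Nice f)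
    {a b L : ℝ} (hf : ∀ x, 0 ≤ x → x ≤ 1 → a < x → x < b → f x ≤ L)
    {x y : ℝ} (hx : 0 ≤ x) (hx1 : x ≤ 1) (hax : a < x) (hxb : x < b)
    (hy : 0 ≤ y) (hy1 : y ≤ 1) (hay : a < y) (hyb : y < b)
    (hLx : u x ≤ L) : u y ≤ L := by
  have := H.neg.N hh hfn.neg (L := -L) (fun t h1 h2 h3 h4 => neg_le_neg (hf t h1 h2 h3 h4))
    hx hx1 hax hxb hy hy1 hay hyb (neg_le_neg hLx)
  linarith

lemma cont_lt {f : ℝ → ℝ} (hf : ContinuousOn f (Icc (0 : ℝ) 1)) {x L : ℝ} (hx : x ∈ Icc (0 : ℝ) 1)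
    (h : f x < L) : ∃ δ > 0, ∀ y, 0 ≤ y → y ≤ 1 → x - δ < y → y < x + δ → f y ≤ L := by
  have := (hf x hx).eventually_lt_const h
  rw [eventually_nhdsWithin_iff, Metric.eventually_nhds_iff] at this
  obtain ⟨δ, hδ, H⟩ := this
  refine ⟨δ, hδ, fun y h1 h2 h3 h4 => (H ?_ ⟨h1, h2⟩).le⟩
  rw [Real.dist_eq, abs_lt]; constructor <;> linarith

lemma cont_gt {f : ℝ → ℝ} (hf : ContinuousOn f (Icc (0 : ℝ) 1)) {x L : ℝ} (hx : x ∈ Icc (0 : ℝ) 1)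
    (h : L < f x) : ∃ δ > 0, ∀ y, 0 ≤ y → y ≤ 1 → x - δ < y → y < x + δ → L ≤ f y := by
  obtain ⟨δ, hδ, H⟩ := cont_lt hf.neg hx (neg_lt_neg h)
  exact ⟨δ, hδ, fun y h1 h2 h3 h4 => neg_le_neg_iff.1 (H y h1 h2 h3 h4)⟩

lemma IsMin.lsc {h : ℝ} (hh : 0 < h) {f u : ℝ → ℝ} (H : IsMin h f u)
    (hf : ContinuousOn f (Icc (0 : ℝ) 1)) {x L : ℝ} (hx : x ∈ Icc (0 : ℝ) 1) (hL : L < u x) :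
    ∃ δ > 0, ∀ y, 0 ≤ y → y ≤ 1 → x - δ < y → y < x + δ → L ≤ u y := by
  have hfn := Nice.of_cont hf
  rcases lt_or_ge L (f x) with h1 | h1
  · obtain ⟨δ, hδ, hd⟩ := cont_gt hf hx h1
    exact ⟨δ, hδ, fun y a1 a2 a3 a4 => H.N hh hfn hd hx.1 hx.2 (by linarith) (by linarith)
      a1 a2 a3 a4 hL.le⟩
  · obtain ⟨L', hL1, hL2⟩ := exists_between hL
    obtain ⟨δ, hδ, hd⟩ := cont_lt hf hx (h1.trans_lt hL1)
    refine ⟨δ, hδ, fun y a1 a2 a3 a4 => ?_⟩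
    by_contra hc
    have := H.N' hh hfn hd a1 a2 a3 a4 hx.1 hx.2 (by linarith) (by linarith) (by linarith)
    linarith

lemma IsMin.cont {h : ℝ} (hh : 0 < h) {f u : ℝ → ℝ} (H : IsMin h f u)
    (hf : ContinuousOn f (Icc (0 : ℝ) 1)) : ContinuousOn u (Icc (0 : ℝ) 1) := by
  intro x hx
  rw [Metric.continuousWithinAt_iff]
  intro ε hε
  obtain ⟨δ1, hδ1, H1⟩ := H.lsc hh hf hx (L := u x - ε / 2) (by linarith)
  obtain ⟨δ2, hδ2, H2⟩ := H.neg.lsc hh hf.neg hx (L := - u x - ε / 2) (by linarith)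
  refine ⟨min δ1 δ2, lt_min hδ1 hδ2, fun {y} hy hyd => ?_⟩
  rw [Real.dist_eq, abs_lt] at hyd
  have m1 := min_le_left δ1 δ2
  have m2 := min_le_right δ1 δ2
  have := H1 y hy.1 hy.2 (by linarith) (by linarith)
  have := H2 y hy.1 hy.2 (by linarith) (by linarith)
  rw [Real.dist_eq, abs_lt]
  constructor <;> linarith

lemma IsMin.locconst_aux {h : ℝ} (hh : 0 < h) {f u : ℝ → ℝ} (H : IsMin h f u)
    (hf : ContinuousOn f (Icc (0 : ℝ) 1)) {x : ℝ} (hx : x ∈ Icc (0 : ℝ) 1) (hne : f x < u x) :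
    ∃ δ > 0, ∀ y, 0 ≤ y → y ≤ 1 → x - δ < y → y < x + δ → u y = u x := by
  have hfn := Nice.of_cont hf
  obtain ⟨L, hL1, hL2⟩ := exists_between hne
  obtain ⟨δ, hδ, hd⟩ := cont_lt hf hx hL1
  refine ⟨δ, hδ, fun y a1 a2 a3 a4 => le_antisymm ?_ ?_⟩
  · exact H.N' hh hfn (fun t b1 b2 b3 b4 => (hd t b1 b2 b3 b4).trans hL2.le) hx.1 hx.2
      (by linarith) (by linarith) a1 a2 a3 a4 le_rfl
  · have := H.N' hh hfn (L := max (u y) L)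
      (fun t b1 b2 b3 b4 => (hd t b1 b2 b3 b4).trans (le_max_right _ _)) a1 a2 a3 a4 hx.1 hx.2
      (by linarith) (by linarith) (le_max_left _ _)
    rcases le_max_iff.1 this with h | h
    · exact h
    · linarith

lemma IsMin.locconst {h : ℝ} (hh : 0 < h) {f u : ℝ → ℝ} (H : IsMin h f u)
    (hf : ContinuousOn f (Icc (0 : ℝ) 1)) {x : ℝ} (hx : x ∈ Icc (0 : ℝ) 1) (hne : u x ≠ f x) :
    ∃ δ > 0, ∀ y, 0 ≤ y → y ≤ 1 → x - δ < y → y < x + δ → u y = u x := by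
  rcases lt_or_gt_of_ne hne with h1 | h1
  · obtain ⟨δ, hδ, hd⟩ := H.neg.locconst_aux hh hf.neg hx (neg_lt_neg h1)
    exact ⟨δ, hδ, fun y h1 h2 h3 h4 => neg_inj.1 (hd y h1 h2 h3 h4)⟩
  · exact H.locconst_aux hh hf hx h1

lemma IsMin.const {h : ℝ} (hh : 0 < h) {f u : ℝ → ℝ} (H : IsMin h f u)
    (hf : ContinuousOn f (Icc (0 : ℝ) 1)) {x s : ℝ} (hx : 0 ≤ x) (hxs : x ≤ s) (hs : s ≤ 1)
    (hne : ∀ z, x < z → z < s → u z ≠ f z) : u x = u s := by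
  rcases hxs.eq_or_lt with rfl | hxs
  · rfl
  have huc := (H.cont hh hf).mono (Icc_subset_Icc hx hs)
  obtain ⟨c, hc, hc'⟩ := exists_hasDerivAt_eq_slope u (fun _ => 0) hxs huc (fun z hz => by
    obtain ⟨δ, hδ, hd⟩ := H.locconst hh hf (x := z) ⟨by linarith [hz.1], by linarith [hz.2]⟩
      (hne z hz.1 hz.2)
    refine (hasDerivAt_const z (u z)).congr_of_eventuallyEq ?_
    filter_upwards [Ioo_mem_nhds hz.1 hz.2,
      Ioo_mem_nhds (by linarith : z - δ < z) (by linarith : z < z + δ)] with t ht ht'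
    exact hd t (by linarith [ht.1]) (by linarith [ht.2]) ht'.1 ht'.2)
  have : s - x ≠ 0 := by linarith [hxs] |> fun (h : 0 < s - x) => h.ne'
  field_simp at hc'
  linarith

lemma IsMin.split {h : ℝ} (hh : 0 < h) {f u : ℝ → ℝ} (H : IsMin h f u)
    (hf : ContinuousOn f (Icc (0 : ℝ) 1)) (hbv : BoundedVariationOn f (Icc (0 : ℝ) 1)) :
    BoundedVariationOn (fun x => f x - u x) (Icc (0 : ℝ) 1) ∧
      V u 0 1 + V (fun x => f x - u x) 0 1 ≤ V f 0 1 := by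
  refine (bv_split zero_le_one hbv fun x y h1 h2 h3 => ?_).2
  have huc := H.cont hh hf
  have hbvx : ∀ a b, x ≤ a → b ≤ y → BoundedVariationOn f (Icc a b) := fun a b ha hb =>
    hbv.mono (Icc_subset_Icc (h1.trans ha) (hb.trans h3))
  have hZc : IsCompact (Icc x y ∩ {z | u z = f z}) := by
    have hcl : IsClosed (Icc x y ∩ (fun z => u z - f z) ⁻¹' {0}) :=
      ((huc.sub hf).mono (Icc_subset_Icc h1 h3)).preimage_isClosed_of_isClosed isClosed_Icc
        isClosed_singleton
    have : Icc x y ∩ {z | u z = f z} = Icc x y ∩ (fun z => u z - f z) ⁻¹' {0} := by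
      ext z; simp [sub_eq_zero]
    rw [this]
    exact isCompact_Icc.of_isClosed_subset hcl inter_subset_left
  by_cases hZ : (Icc x y ∩ {z | u z = f z}).Nonempty
  · obtain ⟨s, hs, hs'⟩ := hZc.exists_isLeast hZ
    obtain ⟨t, ht, ht'⟩ := hZc.exists_isGreatest hZ
    have hst : s ≤ t := hs' ht
    have hus : u s = f s := hs.2
    have hut : u t = f t := ht.2
    have hs1 := hs.1.1
    have hs2 := hs.1.2
    have ht1 := ht.1.1
    have ht2 := ht.1.2
    have e1 : u x = u s := H.const hh hf h1 hs1 (hs2.trans h3) fun z z1 z2 hz => by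
      have := hs' ⟨⟨z1.le, z2.le.trans hs2⟩, hz⟩
      linarith
    have e2 : u t = u y := H.const hh hf (h1.trans ht1) ht2 h3 fun z z1 z2 hz => by
      have := ht' ⟨⟨ht1.trans z1.le, z2.le⟩, hz⟩
      linarith
    have a1 := abs_le_V (hbvx x s le_rfl hs2) hs1
    have a2 := abs_le_V (hbvx s t hs1 ht2) hst
    have a3 := abs_le_V (hbvx t y ht1 le_rfl) ht2
    have b1 := V_add (hbvx x y le_rfl le_rfl) hs1 hs2
    have b2 := V_add (hbvx s y hs1 le_rfl) hst ht2
    have c1 : |u y - u x| = |f t - f s| := by rw [← e2, e1, hus, hut]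
    have c2 : |f y - u y - (f x - u x)| ≤ |f y - f t| + |f s - f x| := by
      rw [← e2, e1, hus, hut]
      have : f y - f t - (f x - f s) = (f y - f t) + (f s - f x) := by ring
      rw [this]; exact abs_add_le _ _
    linarith
  · have : u x = u y := H.const hh hf h1 h2 h3 fun z z1 z2 hz =>
      hZ ⟨z, ⟨z1.le, z2.le⟩, hz⟩
    have a1 := abs_le_V (hbvx x y le_rfl le_rfl) h2
    have c2 : f y - u y - (f x - u x) = f y - f x := by rw [this]; ring
    rw [c2, this, sub_self, abs_zero, zero_add]
    exact a1

/-- variational inequality -/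
lemma IsMin.vi {h : ℝ} (hh : 0 < h) {f u φ : ℝ → ℝ} (H : IsMin h f u) (hf : Nice f)
    (hφ : Nice φ) (K : ℝ) (h0 : φ 0 = 0) (h1 : φ 1 = 0)
    (hK : ∀ t, 0 < t → t ≤ 1 → BoundedVariationOn (fun x => u x + t * φ x) (Icc (0 : ℝ) 1) ∧
      V (fun x => u x + t * φ x) 0 1 ≤ V u 0 1 + t * K) :
    ∫ x in (0 : ℝ)..1, (f x - u x) * φ x ≤ h * K := by
  have hu := Nice.of_bv H.bv
  have n1 := ((hu.sub hf).sq).int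
  have n2 := ((hf.sub hu).mul hφ).int
  have n3 := hφ.sq.int
  have key : ∀ t, 0 < t → t ≤ 1 → ∫ x in (0 : ℝ)..1, (f x - u x) * φ x ≤
      h * K + t * ((1 / 2) * ∫ x in (0 : ℝ)..1, φ x ^ 2) := by
    intro t ht ht1
    obtain ⟨hb, hV⟩ := hK t ht ht1
    have hm := H.minim _ hb (by simp [h0, H.left]) (by simp [h1, H.right])
    have e : ∫ x in (0 : ℝ)..1, (u x + t * φ x - f x) ^ 2 =
        (∫ x in (0 : ℝ)..1, (u x - f x) ^ 2) - 2 * t * (∫ x in (0 : ℝ)..1, (f x - u x) * φ x)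
          + t ^ 2 * ∫ x in (0 : ℝ)..1, φ x ^ 2 := by
      rw [← intervalIntegral.integral_const_mul, ← intervalIntegral.integral_const_mul,
        ← intervalIntegral.integral_sub n1 (n2.const_mul _),
        ← intervalIntegral.integral_add (n1.sub (n2.const_mul _)) (n3.const_mul _)]
      congr 1; ext x; ring
    rw [e] at hm
    have hV' := mul_le_mul_of_nonneg_left hV hh.le
    have : t * (∫ x in (0 : ℝ)..1, (f x - u x) * φ x) ≤
        t * (h * K + t * ((1 / 2) * ∫ x in (0 : ℝ)..1, φ x ^ 2)) := by
      nlinarith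
    exact le_of_mul_le_mul_left this ht
  have hlim : Filter.Tendsto (fun t : ℝ => h * K + t * ((1 / 2) * ∫ x in (0 : ℝ)..1, φ x ^ 2))
      (nhdsWithin 0 (Ioi 0)) (nhds (h * K)) := by
    have : Continuous (fun t : ℝ => h * K + t * ((1 / 2) * ∫ x in (0 : ℝ)..1, φ x ^ 2)) := by
      fun_prop
    have := (this.tendsto 0).mono_left (nhdsWithin_le_nhds (s := Ioi (0 : ℝ)))
    simpa using this
  refine ge_of_tendsto hlim ?_
  filter_upwards [Ioo_mem_nhdsGT (zero_lt_one' ℝ)] with t ht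
  exact key t ht.1 ht.2.le

lemma lin_var {a b : ℝ → ℝ} (ha : BoundedVariationOn a (Icc (0 : ℝ) 1))
    (hb : BoundedVariationOn b (Icc (0 : ℝ) 1)) {c d : ℝ} (hc : 0 ≤ c) (hd : 0 ≤ d) :
    BoundedVariationOn (fun x => c * a x + d * b x) (Icc (0 : ℝ) 1) ∧
      V (fun x => c * a x + d * b x) 0 1 ≤ c * V a 0 1 + d * V b 0 1 := by
  have key : ∀ x y, 0 ≤ x → x ≤ y → y ≤ 1 →
      |(c * a y + d * b y) - (c * a x + d * b x)| ≤
        (c * V a 0 y + d * V b 0 y) - (c * V a 0 x + d * V b 0 x) := by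
    intro x y h1 h2 h3
    have e1 := abs_le_V (ha.mono (Icc_subset_Icc h1 h3)) h2
    have e2 := abs_le_V (hb.mono (Icc_subset_Icc h1 h3)) h2
    rw [V_diff ha h1 h2 h3] at e1
    rw [V_diff hb h1 h2 h3] at e2
    have e3 : (c * a y + d * b y) - (c * a x + d * b x) = c * (a y - a x) + d * (b y - b x) := by
      ring
    rw [e3]
    refine (abs_add_le _ _).trans ?_
    rw [abs_mul, abs_mul, abs_of_nonneg hc, abs_of_nonneg hd]
    nlinarith
  refine ⟨bv_of_le (G := fun x => c * V a 0 x + d * V b 0 x) zero_le_one key, ?_⟩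
  have := V_le (g := fun x => c * a x + d * b x) (G := fun x => c * V a 0 x + d * V b 0 x)
    zero_le_one key
  simpa [V_self] using this

lemma IsMin.subgrad {h : ℝ} (hh : 0 < h) {f u w : ℝ → ℝ} (H : IsMin h f u) (hf : Nice f)
    (hw : BoundedVariationOn w (Icc (0 : ℝ) 1)) (h0 : w 0 = f 0) (h1 : w 1 = f 1) :
    ∫ x in (0 : ℝ)..1, (f x - u x) * (w x - u x) ≤ h * (V w 0 1 - V u 0 1) := by
  refine H.vi hh hf ((Nice.of_bv hw).sub (Nice.of_bv H.bv)) _ (by simp [h0, H.left])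
    (by simp [h1, H.right]) fun t ht ht1 => ?_
  obtain ⟨k1, k2⟩ := lin_var H.bv hw (sub_nonneg.2 ht1) ht.le
  have e : (fun x => u x + t * (w x - u x)) = fun x => (1 - t) * u x + t * w x := by
    ext x; ring
  rw [e]
  exact ⟨k1, by linarith⟩

end TVaux

/-- semigroup / splitting property of the resolvent: let `v` be absolutely
continuous on `[0,1]` whose sets `{v_x > 0}` and `{v_x < 0}` are open with finitely many
connected components (finite unions of open intervals), and let `h₁, h₂ > 0`. If `u¹`
minimizes `J_{h₁,v}` and `u²` minimizes `J_{h₂,u¹}` (over BV functions with the boundary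
values of `v`), then `u²` minimizes `J_{h₁+h₂,v}`. -/
theorem resolvent_semigroup (h₁ h₂ : ℝ) (hh₁ : 0 < h₁) (hh₂ : 0 < h₂)
    (v v' u₁ u₂ : ℝ → ℝ)
    (hv' : IntervalIntegrable v' volume 0 1)
    (hv : ∀ x ∈ Icc (0 : ℝ) 1, v x = v 0 + ∫ t in (0 : ℝ)..x, v' t)
    -- {v_x > 0} and {v_x < 0} are open with finitely many connected components
    (hpos : ∃ (n : ℕ) (c d : Fin n → ℝ),
      {x ∈ Ioo (0 : ℝ) 1 | 0 < v' x} = ⋃ i, Ioo (c i) (d i))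
    (hneg : ∃ (n : ℕ) (c d : Fin n → ℝ),
      {x ∈ Ioo (0 : ℝ) 1 | v' x < 0} = ⋃ i, Ioo (c i) (d i))
    (hu₁adm : BoundedVariationOn u₁ (Icc (0 : ℝ) 1) ∧ u₁ 0 = v 0 ∧ u₁ 1 = v 1)
    (hu₂adm : BoundedVariationOn u₂ (Icc (0 : ℝ) 1) ∧ u₂ 0 = v 0 ∧ u₂ 1 = v 1)
    (hu₁min : ∀ w : ℝ → ℝ, BoundedVariationOn w (Icc (0 : ℝ) 1) → w 0 = v 0 → w 1 = v 1 →
      h₁ * (eVariationOn u₁ (Icc (0 : ℝ) 1)).toReal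
          + (1 / 2) * ∫ x in (0 : ℝ)..1, (u₁ x - v x) ^ 2
        ≤ h₁ * (eVariationOn w (Icc (0 : ℝ) 1)).toReal
          + (1 / 2) * ∫ x in (0 : ℝ)..1, (w x - v x) ^ 2)
    (hu₂min : ∀ w : ℝ → ℝ, BoundedVariationOn w (Icc (0 : ℝ) 1) → w 0 = v 0 → w 1 = v 1 →
      h₂ * (eVariationOn u₂ (Icc (0 : ℝ) 1)).toReal
          + (1 / 2) * ∫ x in (0 : ℝ)..1, (u₂ x - u₁ x) ^ 2
        ≤ h₂ * (eVariationOn w (Icc (0 : ℝ) 1)).toReal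
          + (1 / 2) * ∫ x in (0 : ℝ)..1, (w x - u₁ x) ^ 2) :
    ∀ w : ℝ → ℝ, BoundedVariationOn w (Icc (0 : ℝ) 1) → w 0 = v 0 → w 1 = v 1 →
      (h₁ + h₂) * (eVariationOn u₂ (Icc (0 : ℝ) 1)).toReal
          + (1 / 2) * ∫ x in (0 : ℝ)..1, (u₂ x - v x) ^ 2
        ≤ (h₁ + h₂) * (eVariationOn w (Icc (0 : ℝ) 1)).toReal
          + (1 / 2) * ∫ x in (0 : ℝ)..1, (w x - v x) ^ 2 := by
  intro w hw hw0 hw1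
  obtain ⟨hb₁, hl₁, hr₁⟩ := hu₁adm
  obtain ⟨hb₂, hl₂, hr₂⟩ := hu₂adm
  have hvc : ContinuousOn v (Icc (0 : ℝ) 1) := by
    have h1 : ContinuousOn (fun x => v 0 + ∫ t in (0 : ℝ)..x, v' t) (Icc (0 : ℝ) 1) := by
      have := intervalIntegral.continuousOn_primitive_interval' hv'
        (left_mem_uIcc (a := (0 : ℝ)) (b := 1))
      rw [uIcc_of_le zero_le_one] at this
      exact continuousOn_const.add this
    exact h1.congr hv
  have H₁ : TVaux.IsMin h₁ v u₁ := ⟨hb₁, hl₁, hr₁, hu₁min⟩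
  have H₂ : TVaux.IsMin h₂ u₁ u₂ := ⟨hb₂, by rw [hl₁, hl₂], by rw [hr₁, hr₂],
    fun w hw h0 h1 => hu₂min w hw (by rw [h0, hl₁]) (by rw [h1, hr₁])⟩
  have hu₁c := H₁.cont hh₁ hvc
  obtain ⟨hd, hsplit⟩ := H₂.split hh₂ hu₁c hb₁
  have nv := TVaux.Nice.of_cont hvc
  have n₁ := TVaux.Nice.of_bv hb₁
  have n₂ := TVaux.Nice.of_bv hb₂
  have nw := TVaux.Nice.of_bv hw
  have I1 := H₁.subgrad hh₁ nv hw hw0 hw1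
  have I2 := H₂.subgrad hh₂ n₁ hw (by rw [hw0, hl₁]) (by rw [hw1, hr₁])
  have I3 := H₁.vi hh₁ nv (n₁.sub n₂) (TVaux.V (fun x => u₁ x - u₂ x) 0 1) (by simp [hl₁, hl₂])
    (by simp [hr₁, hr₂]) (fun t ht _ => by
      have := TVaux.lin_var hb₁ hd zero_le_one ht.le
      simpa using this)
  have m1 := ((nv.sub n₁).mul (nw.sub n₁)).int
  have m2 := ((n₁.sub n₂).mul (nw.sub n₂)).int
  have m3 := ((nv.sub n₁).mul (n₁.sub n₂)).int
  have m4 := ((n₂.sub nv).sq).int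
  have m5 := ((nw.sub n₂).sq).int
  have e : ∫ x in (0 : ℝ)..1, (w x - v x) ^ 2 =
      (∫ x in (0 : ℝ)..1, (u₂ x - v x) ^ 2) + (∫ x in (0 : ℝ)..1, (w x - u₂ x) ^ 2)
      - 2 * ((∫ x in (0 : ℝ)..1, (v x - u₁ x) * (w x - u₁ x)) +
        (∫ x in (0 : ℝ)..1, (u₁ x - u₂ x) * (w x - u₂ x)) +
        (∫ x in (0 : ℝ)..1, (v x - u₁ x) * (u₁ x - u₂ x))) := by
    rw [← intervalIntegral.integral_add m4 m5, ← intervalIntegral.integral_add m1 m2,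
      ← intervalIntegral.integral_add (m1.add m2) m3, ← intervalIntegral.integral_const_mul,
      ← intervalIntegral.integral_sub (m4.add m5) (((m1.add m2).add m3).const_mul 2)]
    congr 1; ext x; ring
  have hpos5 : 0 ≤ ∫ x in (0 : ℝ)..1, (w x - u₂ x) ^ 2 :=
    intervalIntegral.integral_nonneg zero_le_one fun x _ => sq_nonneg _
  change (h₁ + h₂) * TVaux.V u₂ 0 1 + _ ≤ (h₁ + h₂) * TVaux.V w 0 1 + _
  rw [e]
  have := mul_le_mul_of_nonneg_left hsplit hh₁.le
  linarith
end

section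
/- Let v ∈ W^{1,∞}(a,b) with v_x ∈ BV(a,b), v(a)=A, v(b)=B, and suppose v has finitely many essential facets. Then the unique minimizer u of J_{h,v} satisfies u_x ∈ BV(a,b) with ‖u_x‖_{BV} ≤ ‖v_x‖_{BV}. -/
open MeasureTheory Set

/-- An essential facet of `f` inside `(a,b)`: a (possibly degenerate) interval of constancy
`[ζ⁻,ζ⁺]` next to which `f` is strictly monotone, forming either a strict local minimum
region (strictly decreasing immediately to the left, strictly increasing immediately to the
right) or a strict local maximum region (the symmetric condition). -/
def IsEssentialFacet (f : ℝ → ℝ) (a b ζm ζp : ℝ) : Prop :=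
  a < ζm ∧ ζm ≤ ζp ∧ ζp < b ∧
  (∀ x ∈ Icc ζm ζp, f x = f ζm) ∧
  ∃ ε > 0,
    ((StrictAntiOn f (Icc (ζm - ε) ζm) ∧ StrictMonoOn f (Icc ζp (ζp + ε))) ∨
     (StrictMonoOn f (Icc (ζm - ε) ζm) ∧ StrictAntiOn f (Icc ζp (ζp + ε))))

lemma aux_V_mono {f : ℝ → ℝ} {x y : ℝ} (hf : BoundedVariationOn f (Icc x y)) {s t : ℝ}
    (hxs : x ≤ s) (hst : s ≤ t) (hty : t ≤ y) :
    |f t - f s| + (eVariationOn f (Icc x s)).toReal ≤ (eVariationOn f (Icc x t)).toReal := by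
  have h1 := eVariationOn.Icc_add_Icc f (s := univ) hxs hst (mem_univ s)
  simp only [univ_inter] at h1
  have b1 : BoundedVariationOn f (Icc x s) := hf.mono (Icc_subset_Icc le_rfl (hst.trans hty))
  have b2 : BoundedVariationOn f (Icc s t) := hf.mono (Icc_subset_Icc hxs hty)
  have h2 := b2.dist_le (right_mem_Icc.2 hst) (left_mem_Icc.2 hst)
  rw [Real.dist_eq] at h2
  rw [← h1, ENNReal.toReal_add b1 b2]
  linarith

lemma aux_evar_le {g : ℝ → ℝ} {x y C : ℝ}
    (H : ∀ (n : ℕ) (t : ℕ → ℝ), Monotone t → (∀ i, t i ∈ Icc x y) →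
      ∑ i ∈ Finset.range n, |g (t (i + 1)) - g (t i)| ≤ C) :
    eVariationOn g (Icc x y) ≤ ENNReal.ofReal C := by
  refine iSup_le ?_
  rintro ⟨n, t, ht, hmem⟩
  simp only [edist_dist, Real.dist_eq]
  rw [← ENNReal.ofReal_sum_of_nonneg (fun _ _ => abs_nonneg _)]
  exact ENNReal.ofReal_le_ofReal (H n t ht hmem)

lemma aux_trunc {f w : ℝ → ℝ} {x y : ℝ} (hf : BoundedVariationOn f (Icc x y))
    (hx : w x = f x)
    (H : ∀ s t, x ≤ s → s ≤ t → t ≤ y →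
      |w t - w s| + (f t - w t) ≤ (f s - w s) + |f t - f s|) :
    eVariationOn w (Icc x y) ≤
      ENNReal.ofReal ((eVariationOn f (Icc x y)).toReal - (f y - w y)) := by
  apply aux_evar_le
  intro n t ht hmem
  have key : ∀ n, ∑ i ∈ Finset.range n, |w (t (i + 1)) - w (t i)| + (f (t n) - w (t n)) ≤
      (eVariationOn f (Icc x (t n))).toReal := by
    intro n
    induction n with
    | zero =>
      have h1 := H x (t 0) le_rfl (hmem 0).1 (hmem 0).2
      have h2 := aux_V_mono hf le_rfl (hmem 0).1 (hmem 0).2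
      have h3 : 0 ≤ (eVariationOn f (Icc x x)).toReal := ENNReal.toReal_nonneg
      have h4 := abs_nonneg (w (t 0) - w x)
      simp only [Finset.range_zero, Finset.sum_empty]
      linarith
    | succ n ih =>
      rw [Finset.sum_range_succ]
      have h1 := H (t n) (t (n+1)) (hmem n).1 (ht n.le_succ) (hmem _).2
      have h2 := aux_V_mono hf (hmem n).1 (ht n.le_succ) (hmem (n+1)).2
      linarith
  have h0 := key n
  have h1 := H (t n) y (hmem n).1 (hmem n).2 le_rfl
  have h2 := aux_V_mono hf (hmem n).1 (hmem n).2 le_rfl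
  have h4 := abs_nonneg (w y - w (t n))
  linarith

/-- variation of the function obtained from `f` by putting `0` off `S`. -/
lemma aux_zero {f : ℝ → ℝ} {a b : ℝ} {S : Set ℝ} [DecidablePred (· ∈ S)]
    (hf : BoundedVariationOn f (Icc a b))
    (hgap : ∀ x ∈ Icc a b, x ∉ S → ∃ p ∈ Icc a b, ∃ q ∈ Icc a b, f p ≤ 0 ∧ 0 ≤ f q ∧
      (∀ z ∈ uIcc x p, z ∉ S) ∧ (∀ z ∈ uIcc x q, z ∉ S)) :
    eVariationOn (fun x => if x ∈ S then f x else 0) (Icc a b) ≤ eVariationOn f (Icc a b) := by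
  rw [← ENNReal.ofReal_toReal hf]
  apply aux_evar_le
  intro n t ht hmem
  set g : ℝ → ℝ := fun x => if x ∈ S then f x else 0 with hg
  set V : ℝ → ℝ := fun x => (eVariationOn f (Icc a x)).toReal with hV
  have hVm : ∀ s t, a ≤ s → s ≤ t → t ≤ b → |f t - f s| + V s ≤ V t :=
    fun s t h1 h2 h3 => aux_V_mono hf h1 h2 h3
  have hV0 : ∀ s, 0 ≤ V s := fun s => ENNReal.toReal_nonneg
  -- choose a point adapted to the neighbouring values
  have hchoice : ∀ x ∈ Icc a b, x ∉ S → ∀ c r : ℝ, ∃ p ∈ Icc a b, (∀ z ∈ uIcc x p, z ∉ S) ∧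
      |c| + |r| ≤ |c - f p| + |f p - r| := by
    intro x hx hxS c r
    obtain ⟨p, hp, q, hq, hp0, hq0, hpS, hqS⟩ := hgap x hx hxS
    by_cases hcr : 0 ≤ c + r
    · refine ⟨p, hp, hpS, ?_⟩
      rcases abs_cases c with ⟨h1, _⟩ | ⟨h1, _⟩ <;> rcases abs_cases r with ⟨h2, _⟩ | ⟨h2, _⟩ <;>
      rcases abs_cases (c - f p) with ⟨h3, _⟩ | ⟨h3, _⟩ <;>
      rcases abs_cases (f p - r) with ⟨h4, _⟩ | ⟨h4, _⟩ <;> rw [h1, h2, h3, h4] <;> linarith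
    · refine ⟨q, hq, hqS, ?_⟩
      rcases abs_cases c with ⟨h1, _⟩ | ⟨h1, _⟩ <;> rcases abs_cases r with ⟨h2, _⟩ | ⟨h2, _⟩ <;>
      rcases abs_cases (c - f q) with ⟨h3, _⟩ | ⟨h3, _⟩ <;>
      rcases abs_cases (f q - r) with ⟨h4, _⟩ | ⟨h4, _⟩ <;> rw [h1, h2, h3, h4] <;> linarith
  have key : ∀ n, ∀ r : ℝ, ∃ p ∈ Icc a b, (p = t n ∨ ∀ z ∈ uIcc (t n) p, z ∉ S) ∧
      ∑ i ∈ Finset.range n, |g (t (i + 1)) - g (t i)| + |g (t n) - r| ≤ V p + |f p - r| := by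
    intro n
    induction n with
    | zero =>
      intro r
      by_cases h : t 0 ∈ S
      · refine ⟨t 0, hmem 0, Or.inl rfl, ?_⟩
        simp only [hg, h, if_true, Finset.range_zero, Finset.sum_empty]
        linarith [hV0 (t 0)]
      · obtain ⟨p, hp, hpS, hle⟩ : ∃ p ∈ Icc a b, (∀ z ∈ uIcc (t 0) p, z ∉ S) ∧
          |r| ≤ |f p - r| := by
          obtain ⟨p, hp, q, hq, hp0, hq0, hpS, hqS⟩ := hgap _ (hmem 0) h
          rcases le_total 0 r with h0 | h0
          · exact ⟨p, hp, hpS, by rw [abs_of_nonneg h0, abs_of_nonpos] <;> linarith⟩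
          · exact ⟨q, hq, hqS, by rw [abs_of_nonpos h0, abs_of_nonneg] <;> linarith⟩
        refine ⟨p, hp, Or.inr hpS, ?_⟩
        simp only [hg, h, if_false, Finset.range_zero, Finset.sum_empty, zero_sub, abs_neg]
        linarith [hV0 p]
    | succ n ih =>
      intro r
      rw [Finset.sum_range_succ]
      have hle := ht n.le_succ
      by_cases h : t (n+1) ∈ S
      · obtain ⟨p, hp, hpS, hs⟩ := ih (f (t (n+1)))
        have hpt : p ≤ t (n+1) := by
          rcases hpS with rfl | hpS
          · exact hle
          · by_contra hc
            push Not at hc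
            exact hpS (t (n+1)) (mem_uIcc.2 (Or.inl ⟨hle, hc.le⟩)) h
        refine ⟨t (n+1), hmem _, Or.inl rfl, ?_⟩
        have h1 : g (t (n+1)) = f (t (n+1)) := by simp [hg, h]
        have h2 := hVm p (t (n+1)) hp.1 hpt (hmem _).2
        rw [abs_sub_comm] at h2
        rw [h1, abs_sub_comm (f (t (n+1))) (g (t n))]
        linarith
      · have h1 : g (t (n+1)) = 0 := by simp [hg, h]
        by_cases hsame : ∀ z ∈ uIcc (t n) (t (n+1)), z ∉ S
        · obtain ⟨p, hp, hpS, hs⟩ := ih r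
          have h2 : g (t n) = 0 := by simp [hg, hsame (t n) left_mem_uIcc]
          refine ⟨p, hp, Or.inr ?_, by rw [h1]; rw [h2] at hs ⊢; simpa using hs⟩
          rcases hpS with rfl | hpS
          · rwa [uIcc_comm]
          · intro z hz
            rcases uIcc_subset_uIcc_union_uIcc (b := t n) hz with hz | hz
            · exact hsame z (uIcc_comm (t n) _ ▸ hz)
            · exact hpS z hz
        · push Not at hsame
          obtain ⟨m, hm, hmS⟩ := hsame
          rw [uIcc_of_le hle] at hm
          obtain ⟨p, hp, hpS, hs⟩ := ih 0
          obtain ⟨p', hp', hpS', hs'⟩ := hchoice (t (n+1)) (hmem _) h (f p) r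
          have hpm : p ≤ m := by
            rcases hpS with rfl | hpS
            · exact hm.1
            · by_contra hc
              push Not at hc
              exact hpS m (mem_uIcc.2 (Or.inl ⟨hm.1, hc.le⟩)) hmS
          have hmp : m ≤ p' := by
            by_contra hc
            push Not at hc
            exact hpS' m (mem_uIcc.2 (Or.inr ⟨hc.le, hm.2⟩)) hmS
          refine ⟨p', hp', Or.inr hpS', ?_⟩
          have h2 := hVm p p' hp.1 (hpm.trans hmp) hp'.2
          rw [abs_sub_comm] at h2
          rw [h1, abs_sub_comm 0 (g (t n))]
          simp only [sub_zero, zero_sub, abs_neg] at *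
          linarith
  obtain ⟨p, hp, -, hs⟩ := key n (f b)
  have h2 := hVm p b hp.1 hp.2 le_rfl
  rw [abs_sub_comm] at h2
  have := abs_nonneg (g (t n) - f b)
  linarith

lemma aux_bv_int {f : ℝ → ℝ} {a b : ℝ} (hab : a ≤ b) (hf : BoundedVariationOn f (Icc a b)) :
    IntervalIntegrable f volume a b := by
  obtain ⟨p, q, hp, hq, rfl⟩ := hf.locallyBoundedVariationOn.exists_monotoneOn_sub_monotoneOn
  rw [← uIcc_of_le hab] at hp hq
  exact hp.intervalIntegrable.sub hq.intervalIntegrable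

lemma aux_sq_int {f v : ℝ → ℝ} {a b : ℝ} (hab : a ≤ b) (hf : BoundedVariationOn f (Icc a b))
    (hv : ContinuousOn v (Icc a b)) :
    IntervalIntegrable (fun x => (f x - v x) ^ 2) volume a b := by
  have h1 := aux_bv_int hab (hf.mul hf)
  have h2 := aux_bv_int hab hf
  rw [← uIcc_of_le hab] at hv
  have h3 := h2.mul_continuousOn hv
  have h4 : IntervalIntegrable (fun x => v x ^ 2) volume a b := (hv.pow 2).intervalIntegrable
  have h5 := (h1.sub (h3.const_mul 2)).add h4
  refine h5.congr (fun x _ => ?_)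
  simp only [Pi.mul_apply, Pi.add_apply, Pi.sub_apply]
  ring

/-- `u` minimizes the functional. -/
def AuxMin (a b h : ℝ) (v u : ℝ → ℝ) : Prop :=
  BoundedVariationOn u (Icc a b) ∧ u a = v a ∧ u b = v b ∧
  ∀ w : ℝ → ℝ, BoundedVariationOn w (Icc a b) → w a = v a → w b = v b →
      h * (eVariationOn u (Icc a b)).toReal + (1 / 2) * ∫ x in a..b, (u x - v x) ^ 2
        ≤ h * (eVariationOn w (Icc a b)).toReal + (1 / 2) * ∫ x in a..b, (w x - v x) ^ 2

lemma aux_add {f : ℝ → ℝ} {x y z : ℝ} (hxy : x ≤ y) (hyz : y ≤ z) :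
    eVariationOn f (Icc x z) = eVariationOn f (Icc x y) + eVariationOn f (Icc y z) := by
  have h1 := eVariationOn.Icc_add_Icc f (s := univ) hxy hyz (mem_univ y)
  simpa only [univ_inter] using h1.symm

lemma aux_step {u w : ℝ → ℝ} {K s t y : ℝ} (hst : s ≤ t)
    (hw : ∀ r, s ≤ r → w r = if r < y then min (u r) K else u r) :
    |w t - w s| + (u t - w t) ≤ (u s - w s) + |u t - u s| := by
  have h1 := hw s le_rfl
  have h2 := hw t hst
  by_cases ht : t < y
  · rw [if_pos ht] at h2
    rw [if_pos (hst.trans_lt ht)] at h1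
    rw [h1, h2]
    rcases le_total (u s) K with h3 | h3 <;> rcases le_total (u t) K with h4 | h4 <;>
      simp only [min_eq_left, min_eq_right, h3, h4] <;>
      rcases abs_cases (u t - u s) with ⟨h5, _⟩ | ⟨h5, _⟩ <;> rw [h5] <;>
      first
        | linarith
        | (rw [abs_of_nonneg (by linarith)]; linarith)
        | (rw [abs_of_nonpos (by linarith)]; linarith)
  · rw [if_neg ht] at h2
    rw [h2]
    have : w s ≤ u s := by rw [h1]; split_ifs <;> simp
    have h3 := abs_sub_le (u t) (u s) (w s)
    rw [abs_of_nonneg (sub_nonneg.2 this)] at h3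
    linarith

lemma aux_star_right {a b h : ℝ} {v u : ℝ → ℝ} (hh : 0 < h) (hv : ContinuousOn v (Icc a b))
    (hu : AuxMin a b h v u) {x z : ℝ} (hax : a ≤ x) (hxz : x ≤ z) (hzb : z ≤ b) :
    u z ≤ u x ∨ ∃ s ∈ Icc x z, u z ≤ v s := by
  by_contra hcon
  push Not at hcon
  obtain ⟨hux, hvs⟩ := hcon
  obtain ⟨hubv, hua, hub, humin⟩ := hu
  have hxz' : x < z := lt_of_le_of_ne hxz (by rintro rfl; exact lt_irrefl _ hux)
  have hzb' : z < b := lt_of_le_of_ne hzb (by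
    rintro rfl; have := hvs z (right_mem_Icc.2 hxz); linarith)
  have hab : a < b := by linarith
  obtain ⟨m, hm, hmax⟩ := isCompact_Icc.exists_isMaxOn (nonempty_Icc.2 hxz)
    (hv.mono (Icc_subset_Icc hax hzb))
  obtain ⟨K, hK1, hK2⟩ := exists_between (max_lt hux (hvs m hm))
  have hKx : u x < K := (le_max_left _ _).trans_lt hK1
  have hKv : ∀ s ∈ Icc x z, v s < K := fun s hs =>
    ((hmax hs).trans (le_max_right _ _)).trans_lt hK1
  -- extend beyond z
  obtain ⟨y0, hzy0, hy0b, hKv0⟩ : ∃ y0, z < y0 ∧ y0 ≤ b ∧ ∀ s ∈ Icc x y0, v s < K := by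
    have hc : ContinuousWithinAt v (Ici z) z :=
      ((hv z ⟨hax.trans hxz, hzb⟩).mono_of_mem_nhdsWithin (by
        filter_upwards [Icc_mem_nhdsGE hzb'] with t ht
        exact ⟨hax.trans (hxz.trans ht.1), ht.2⟩))
    have h1 := hc.eventually_lt_const (hKv z (right_mem_Icc.2 hxz))
    have h2 := h1.and (Icc_mem_nhdsGE hzb')
    obtain ⟨y, hy, hy'⟩ := (mem_nhdsGE_iff_exists_Icc_subset).1 h2
    refine ⟨y, hy, ?_, ?_⟩
    · exact (hy' (right_mem_Icc.2 (le_of_lt hy))).2.2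
    · intro s hs
      rcases le_total s z with h3 | h3
      · exact hKv s ⟨hs.1, h3⟩
      · exact (hy' ⟨h3, hs.2⟩).1
  -- generic facts about the competitor
  have gen : ∀ y, z < y → y ≤ y0 → (u y ≤ K ∨ ∀ t ∈ Ioc z y, K < u t) → False := by
    intro y hzy hyy0 hcase
    set w : ℝ → ℝ := fun t => if x ≤ t ∧ t < y then min (u t) K else u t with hw
    have hyb : y ≤ b := hyy0.trans hy0b
    have hwr : ∀ r, x ≤ r → w r = if r < y then min (u r) K else u r := by
      intro r hr; simp [hw, hr]
    have hwx : w x = u x := by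
      rw [hwr x le_rfl, if_pos (hxz'.trans hzy), min_eq_left hKx.le]
    have hwl : EqOn w u (Icc a x) := by
      intro t ht
      rcases eq_or_lt_of_le ht.2 with rfl | h1
      · exact hwx
      · simp [hw, h1]
    have hwge : ∀ t, y ≤ t → w t = u t := by
      intro t ht; simp [hw, ht]
    have hwa : w a = v a := by rw [hwl (left_mem_Icc.2 hax), hua]
    have hwb : w b = v b := by rw [hwge b hyb, hub]
    have hbx : BoundedVariationOn u (Icc a x) := hubv.mono (Icc_subset_Icc le_rfl (hxz.trans hzb))
    have hbxb : BoundedVariationOn u (Icc x b) := hubv.mono (Icc_subset_Icc hax le_rfl)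
    have e1 : eVariationOn w (Icc a x) = eVariationOn u (Icc a x) := eVariationOn.eq_of_eqOn hwl
    have e2 : eVariationOn w (Icc x b) ≤ eVariationOn u (Icc x b) := by
      have := aux_trunc (w := w) hbxb hwx (fun s t h1 h2 h3 =>
        aux_step h2 (fun r hr => hwr r (h1.trans hr)))
      rwa [hwge b hyb, sub_self, sub_zero, ENNReal.ofReal_toReal hbxb] at this
    have e3 : eVariationOn w (Icc a b) ≤ eVariationOn u (Icc a b) := by
      rw [aux_add hax (hxz.trans hzb), aux_add (f := u) hax (hxz.trans hzb), e1]
      gcongr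
    have hwbv : BoundedVariationOn w (Icc a b) := ne_top_of_le_ne_top hubv e3
    have hmin := humin w hwbv hwa hwb
    have iw := aux_sq_int hab.le hwbv hv
    have iu := aux_sq_int hab.le hubv hv
    have hptle : ∀ t ∈ Icc a b, (w t - v t) ^ 2 ≤ (u t - v t) ^ 2 := by
      intro t ht
      by_cases h1 : x ≤ t ∧ t < y
      · have h2 : w t = min (u t) K := by simp [hw, h1]
        have h3 := hKv0 t ⟨h1.1, h1.2.le.trans hyy0⟩
        rcases le_total (u t) K with h4 | h4
        · rw [h2, min_eq_left h4]
        · rw [h2, min_eq_right h4]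
          apply pow_le_pow_left₀ <;> linarith
      · have h2 : w t = u t := by simp only [hw, h1, if_false]
        rw [h2]
    have e3' := ENNReal.toReal_mono hubv e3
    rcases hcase with hcase | hcase
    · -- strict decrease of the variation
      have hintegral : ∫ t in a..b, (w t - v t) ^ 2 ≤ ∫ t in a..b, (u t - v t) ^ 2 :=
        intervalIntegral.integral_mono_on hab.le iw iu hptle
      have hbxz : BoundedVariationOn u (Icc x z) := hubv.mono (Icc_subset_Icc hax hzb)
      have hbzy : BoundedVariationOn u (Icc z y) :=
        hubv.mono (Icc_subset_Icc (hax.trans hxz) hyb)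
      have hbyb : BoundedVariationOn u (Icc y b) :=
        hubv.mono (Icc_subset_Icc (by linarith) le_rfl)
      have hwz : w z = K := by
        rw [hwr z hxz, if_pos hzy, min_eq_right hK2.le]
      have f1 := aux_trunc (w := w) hbxz hwx (fun s t h1 h2 h3 =>
        aux_step h2 (fun r hr => hwr r (h1.trans hr)))
      rw [hwz] at f1
      have f1' : (eVariationOn w (Icc x z)).toReal < (eVariationOn u (Icc x z)).toReal := by
        have g1 : 0 < (eVariationOn u (Icc x z)).toReal := by
          have := hbxz.sub_le (right_mem_Icc.2 hxz) (left_mem_Icc.2 hxz)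
          linarith
        refine (ENNReal.toReal_lt_toReal (ne_top_of_le_ne_top ENNReal.ofReal_ne_top f1) hbxz).2 ?_
        refine f1.trans_lt ?_
        rw [ENNReal.ofReal_lt_iff_lt_toReal _ hbxz]
        · linarith
        · have := hbxz.sub_le (right_mem_Icc.2 hxz) (left_mem_Icc.2 hxz)
          linarith
      have f2 : eVariationOn w (Icc z y) ≤ eVariationOn u (Icc z y) := by
        have hE : EqOn w ((fun r => min r K) ∘ u) (Icc z y) := by
          intro t ht
          rcases eq_or_lt_of_le ht.2 with h1 | h1
          · rw [h1, hwge y le_rfl]; simp [hcase]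
          · rw [hwr t (hxz.trans ht.1), if_pos h1]; rfl
        rw [eVariationOn.eq_of_eqOn hE]
        have hL : LipschitzWith 1 (fun r : ℝ => min r K) := LipschitzWith.id.min_const K
        have := (hL.lipschitzOnWith (s := univ)).comp_eVariationOn_le
          (g := u) (s := Icc z y) (mapsTo_univ _ _)
        simpa using this
      have f3 : eVariationOn w (Icc y b) = eVariationOn u (Icc y b) :=
        eVariationOn.eq_of_eqOn (fun t ht => hwge t ht.1)
      have hsplit : ∀ f : ℝ → ℝ, BoundedVariationOn f (Icc a b) →
          (eVariationOn f (Icc a b)).toReal = (eVariationOn f (Icc a x)).toReal +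
          (eVariationOn f (Icc x z)).toReal + (eVariationOn f (Icc z y)).toReal +
          (eVariationOn f (Icc y b)).toReal := by
        intro f hf
        have b1 : eVariationOn f (Icc a x) ≠ ⊤ := hf.mono (Icc_subset_Icc le_rfl (by linarith))
        have b2 : eVariationOn f (Icc x z) ≠ ⊤ := hf.mono (Icc_subset_Icc hax hzb)
        have b3 : eVariationOn f (Icc z y) ≠ ⊤ := hf.mono (Icc_subset_Icc (by linarith) hyb)
        have b4 : eVariationOn f (Icc y b) ≠ ⊤ := hf.mono (Icc_subset_Icc (by linarith) le_rfl)
        rw [aux_add (y := y) (by linarith) hyb, aux_add (y := z) (by linarith) hzy.le,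
          aux_add hax hxz]
        rw [ENNReal.toReal_add, ENNReal.toReal_add, ENNReal.toReal_add] <;>
          simp [b1, b2, b3, b4]
      have s1 := hsplit w hwbv
      have s2 := hsplit u hubv
      have f2' := ENNReal.toReal_mono hbzy f2
      rw [e1, f3] at s1
      have : (eVariationOn w (Icc a b)).toReal < (eVariationOn u (Icc a b)).toReal := by linarith
      have := mul_lt_mul_of_pos_left this hh
      linarith
    · have hintegral : ∫ t in a..b, (w t - v t) ^ 2 < ∫ t in a..b, (u t - v t) ^ 2 := by
        apply intervalIntegral.integral_lt_integral_of_ae_le_of_measure_setOfPred_lt_ne_zero hab.le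
          iw iu
        · exact (ae_restrict_mem measurableSet_Ioc).mono
            (fun t ht => hptle t (Ioc_subset_Icc_self ht))
        · have hsub : Ioo z y ⊆ {t | (w t - v t) ^ 2 < (u t - v t) ^ 2} ∩ Ioc a b := by
            intro t ht
            refine ⟨?_, by linarith [ht.1], by linarith [ht.2]⟩
            have h2 : w t = K := by
              rw [hwr t (by linarith [ht.1]), if_pos ht.2,
                min_eq_right (hcase t ⟨ht.1, ht.2.le⟩).le]
            have h3 := hKv0 t ⟨by linarith [ht.1], by linarith [ht.2]⟩
            have h4 := hcase t ⟨ht.1, ht.2.le⟩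
            simp only [mem_ofPred_eq]
            rw [h2]
            apply pow_lt_pow_left₀ _ _ two_ne_zero <;> linarith
          have h5 : 0 < volume (Ioo z y) := by simp [hzy]
          rw [Measure.restrict_apply' measurableSet_Ioc]
          exact (h5.trans_le (measure_mono hsub)).ne'
      have := mul_le_mul_of_nonneg_left e3' hh.le
      linarith
  by_cases hA : ∃ y, z < y ∧ y ≤ y0 ∧ u y ≤ K
  · obtain ⟨y, h1, h2, h3⟩ := hA
    exact gen y h1 h2 (Or.inl h3)
  · push Not at hA
    exact gen y0 hzy0 le_rfl (Or.inr fun t ht => hA t ht.1 ht.2)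

lemma AuxMin.neg {a b h : ℝ} {v u : ℝ → ℝ} (hu : AuxMin a b h v u) :
    AuxMin a b h (fun t => - v t) (fun t => - u t) := by
  have hvar : ∀ f : ℝ → ℝ, eVariationOn (fun t => - f t) (Icc a b) = eVariationOn f (Icc a b) := by
    intro f; simp [eVariationOn, edist_neg_neg]
  obtain ⟨h1, h2, h3, h4⟩ := hu
  refine ⟨by rw [BoundedVariationOn, hvar]; exact h1, by simp only [h2], by simp only [h3], ?_⟩
  intro w hw ha hb
  have h5 := h4 (fun t => - w t) (by rw [BoundedVariationOn, hvar]; exact hw)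
    (by simp [ha]) (by simp [hb])
  rw [hvar] at h5 ⊢
  have e1 : ∀ t, (- w t - v t) ^ 2 = (w t - - v t) ^ 2 := fun t => by ring
  have e2 : ∀ t, (- u t - - v t) ^ 2 = (u t - v t) ^ 2 := fun t => by ring
  simp only [e1, e2] at h5 ⊢
  exact h5

lemma AuxMin.refl {a b h : ℝ} {v u : ℝ → ℝ} (hu : AuxMin a b h v u) :
    AuxMin a b h (fun t => v (a + b - t)) (fun t => u (a + b - t)) := by
  have hvar : ∀ f : ℝ → ℝ,
      eVariationOn (fun t => f (a + b - t)) (Icc a b) = eVariationOn f (Icc a b) := by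
    intro f
    have := eVariationOn.comp_eq_of_antitoneOn f (t := Icc a b) (fun t => a + b - t)
      (fun s _ t _ hst => by simp only; linarith)
    simp only [image_const_sub_Icc] at this
    rw [show a + b - b = a by ring, show a + b - a = b by ring] at this
    exact this
  have hintegral : ∀ f : ℝ → ℝ, ∫ t in a..b, f (a + b - t) = ∫ t in a..b, f t := by
    intro f
    rw [intervalIntegral.integral_comp_sub_left (fun t => f t)]
    rw [show a + b - b = a by ring, show a + b - a = b by ring]
  obtain ⟨h1, h2, h3, h4⟩ := hu
  have ea : a + b - a = b := by ring
  have eb : a + b - b = a := by ring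
  refine ⟨by rw [BoundedVariationOn, hvar]; exact h1, by simp only [ea, h3], by simp only [eb, h2], ?_⟩
  intro w hw ha hb
  have h5 := h4 (fun t => w (a + b - t)) (by rw [BoundedVariationOn, hvar]; exact hw)
    (by simp only [ea, hb, eb]) (by simp only [eb, ha, ea])
  rw [hvar] at h5 ⊢
  rw [hintegral (fun t => (u t - v t) ^ 2)]
  have e := hintegral (fun t => (w (a + b - t) - v t) ^ 2)
  simp only [sub_sub_cancel] at e
  rw [e]
  exact h5

lemma aux_star_up {a b h : ℝ} {v u : ℝ → ℝ} (hh : 0 < h) (hv : ContinuousOn v (Icc a b))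
    (hu : AuxMin a b h v u) {x z : ℝ} (hx : x ∈ Icc a b) (hz : z ∈ Icc a b) :
    u z ≤ u x ∨ ∃ s ∈ uIcc x z, u z ≤ v s := by
  rcases le_total x z with hxz | hxz
  · rw [uIcc_of_le hxz]
    exact aux_star_right hh hv hu hx.1 hxz hz.2
  · rw [uIcc_of_ge hxz]
    have hv' : ContinuousOn (fun t => v (a + b - t)) (Icc a b) := by
      apply hv.comp (by fun_prop)
      intro t ht
      exact ⟨by linarith [ht.2], by linarith [ht.1]⟩
    rcases aux_star_right hh hv' hu.refl (x := a + b - x) (z := a + b - z)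
      (by linarith [hx.2]) (by linarith) (by linarith [hz.1]) with h1 | ⟨s, hs, h1⟩
    · left; simpa using h1
    · right
      refine ⟨a + b - s, ⟨by linarith [hs.2], by linarith [hs.1]⟩, by simpa using h1⟩

lemma aux_star_down {a b h : ℝ} {v u : ℝ → ℝ} (hh : 0 < h) (hv : ContinuousOn v (Icc a b))
    (hu : AuxMin a b h v u) {x z : ℝ} (hx : x ∈ Icc a b) (hz : z ∈ Icc a b) :
    u x ≤ u z ∨ ∃ s ∈ uIcc x z, v s ≤ u z := by
  rcases aux_star_up hh hv.neg hu.neg hx hz with h1 | ⟨s, hs, h1⟩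
  · left; linarith
  · exact Or.inr ⟨s, hs, by simpa using h1⟩

/-- Let `v ∈ W^{1,∞}(a,b)` with `v_x ∈ BV(a,b)`, `v(a)=A`, `v(b)=B`, and with
finitely many essential facets. Then the unique minimizer `u` of `J_{h,v}` satisfies
`u_x ∈ BV(a,b)` with `‖u_x‖_{BV} ≤ ‖v_x‖_{BV}`. -/
theorem minimizer_derivative_BV_estimate (a b A B h : ℝ) (hab : a < b) (hh : 0 < h)
    (v v' u : ℝ → ℝ)
    -- v is Lipschitz with a.e. derivative v' of bounded variation
    (hvlip : ∃ M : NNReal, LipschitzOnWith M v (Icc a b))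
    (hv' : IntervalIntegrable v' volume a b)
    (hvrep : ∀ x ∈ Icc a b, v x = v a + ∫ t in a..x, v' t)
    (hv'BV : BoundedVariationOn v' (Icc a b))
    (hA : v a = A) (hB : v b = B)
    -- v has finitely many essential facets
    (hfin : {ζ : ℝ × ℝ | IsEssentialFacet v a b ζ.1 ζ.2}.Finite)
    -- u is the minimizer of J_{h,v}
    (huadm : BoundedVariationOn u (Icc a b) ∧ u a = A ∧ u b = B)
    (humin : ∀ w : ℝ → ℝ, BoundedVariationOn w (Icc a b) → w a = A → w b = B →
      h * (eVariationOn u (Icc a b)).toReal + (1 / 2) * ∫ x in a..b, (u x - v x) ^ 2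
        ≤ h * (eVariationOn w (Icc a b)).toReal + (1 / 2) * ∫ x in a..b, (w x - v x) ^ 2) :
    ∃ u' : ℝ → ℝ,
      IntervalIntegrable u' volume a b ∧
      (∀ x ∈ Icc a b, u x = u a + ∫ t in a..x, u' t) ∧
      BoundedVariationOn u' (Icc a b) ∧
      (eVariationOn u' (Icc a b)).toReal + ∫ x in a..b, |u' x|
        ≤ (eVariationOn v' (Icc a b)).toReal + ∫ x in a..b, |v' x| := by
  classical
  obtain ⟨M, hM⟩ := hvlip
  have hvc : ContinuousOn v (Icc a b) := hM.continuousOn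
  have hmin : AuxMin a b h v u := by
    subst hA hB
    exact ⟨huadm.1, huadm.2.1, huadm.2.2, humin⟩
  have hua : u a = v a := hmin.2.1
  have hub : u b = v b := hmin.2.2.1
  -- `u` is Lipschitz
  have hLip1 : ∀ x ∈ Icc a b, ∀ z ∈ Icc a b, u z - u x ≤ M * |z - x| := by
    intro x hx z hz
    by_contra hc
    push Not at hc
    have hpos : 0 ≤ (M : ℝ) * |z - x| := by positivity
    rcases aux_star_up hh hvc hmin hx hz with h1 | ⟨s, hs, h1⟩
    · linarith
    rcases aux_star_down hh hvc hmin hz hx with h2 | ⟨r, hr, h2⟩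
    · linarith
    have hsub : uIcc x z ⊆ Icc a b := ordConnected_Icc.uIcc_subset hx hz
    rw [uIcc_comm] at hr
    have h3 := hM.dist_le_mul s (hsub hs) r (hsub hr)
    have h4 : dist s r ≤ |z - x| := by
      have := Real.dist_le_of_mem_uIcc hs hr
      rwa [Real.dist_eq x z, abs_sub_comm] at this
    have h5 : (M : ℝ) * dist s r ≤ M * |z - x| := by gcongr
    have h6 := le_abs_self (v s - v r)
    rw [Real.dist_eq (v s)] at h3
    linarith
  have hLip : LipschitzOnWith M u (Icc a b) := by
    apply LipschitzOnWith.of_dist_le_mul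
    intro x hx z hz
    rw [Real.dist_eq, Real.dist_eq, abs_le]
    have h1 := hLip1 x hx z hz
    have h2 := hLip1 z hz x hx
    rw [abs_sub_comm] at h1
    constructor <;> linarith
  have huc : ContinuousOn u (Icc a b) := hLip.continuousOn
  -- `u` is locally constant off the contact set
  have hloc : ∀ x ∈ Ioo a b, u x ≠ v x → HasDerivAt u 0 x := by
    intro x hx hne
    have hxI := Ioo_subset_Icc_self hx
    have hcat : ContinuousAt v x := hvc.continuousAt (Icc_mem_nhds hx.1 hx.2)
    have hev : ∀ᶠ z in nhds x, u z = u x := by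
      rcases lt_or_gt_of_ne hne with hlt | hgt
      · have e1 : {s | u x < v s ∧ s ∈ Ioo a b} ∈ nhds x :=
          (hcat.eventually_const_lt hlt).and (Ioo_mem_nhds hx.1 hx.2)
        obtain ⟨l, r, hlr, hsub⟩ := mem_nhds_iff_exists_Ioo_subset.1 e1
        filter_upwards [Ioo_mem_nhds hlr.1 hlr.2] with z hz
        have hzI := Ioo_subset_Icc_self (hsub hz).2
        have hss : ∀ s ∈ uIcc x z, u x < v s := fun s hs =>
          (hsub (ordConnected_Ioo.uIcc_subset hlr hz hs)).1
        apply le_antisymm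
        · rcases aux_star_down hh hvc hmin hzI hxI with h1 | ⟨s, hs, h1⟩
          · exact h1
          · rw [uIcc_comm] at hs
            linarith [hss s hs]
        · rcases aux_star_down hh hvc hmin hxI hzI with h1 | ⟨s, hs, h1⟩
          · exact h1
          · linarith [hss s hs]
      · have e1 : {s | v s < u x ∧ s ∈ Ioo a b} ∈ nhds x :=
          (hcat.eventually_lt_const hgt).and (Ioo_mem_nhds hx.1 hx.2)
        obtain ⟨l, r, hlr, hsub⟩ := mem_nhds_iff_exists_Ioo_subset.1 e1
        filter_upwards [Ioo_mem_nhds hlr.1 hlr.2] with z hz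
        have hzI := Ioo_subset_Icc_self (hsub hz).2
        have hss : ∀ s ∈ uIcc x z, v s < u x := fun s hs =>
          (hsub (ordConnected_Ioo.uIcc_subset hlr hz hs)).1
        apply le_antisymm
        · rcases aux_star_up hh hvc hmin hxI hzI with h1 | ⟨s, hs, h1⟩
          · exact h1
          · linarith [hss s hs]
        · rcases aux_star_up hh hvc hmin hzI hxI with h1 | ⟨s, hs, h1⟩
          · exact h1
          · rw [uIcc_comm] at hs
            linarith [hss s hs]
    exact (hasDerivAt_const x (u x)).congr_of_eventuallyEq hev
  -- the contact set
  let S : Set ℝ := {x | u x = v x}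
  have hScl : ∀ c d, a ≤ c → d ≤ b → IsCompact (Icc c d ∩ S) := by
    intro c d hc hd
    have h1 : ContinuousOn (fun x => u x - v x) (Icc c d) :=
      (huc.sub hvc).mono (Icc_subset_Icc hc hd)
    have h2 := h1.preimage_isClosed_of_isClosed isClosed_Icc (isClosed_singleton (x := (0 : ℝ)))
    have h3 : Icc c d ∩ S = Icc c d ∩ (fun x => u x - v x) ⁻¹' {0} := by
      ext x
      simp [S, sub_eq_zero]
    rw [h3]
    exact isCompact_Icc.of_isClosed_subset h2 inter_subset_left
  have hgap : ∀ x ∈ Icc a b, x ∉ S → ∃ p ∈ Icc a b, ∃ q ∈ Icc a b, v' p ≤ 0 ∧ 0 ≤ v' q ∧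
      (∀ z ∈ uIcc x p, z ∉ S) ∧ (∀ z ∈ uIcc x q, z ∉ S) := by
    intro x hx hxS
    obtain ⟨c, hc⟩ := (hScl a x le_rfl hx.2).exists_isGreatest ⟨a, left_mem_Icc.2 hx.1, hua⟩
    obtain ⟨d, hd⟩ := (hScl x b hx.1 le_rfl).exists_isLeast ⟨b, right_mem_Icc.2 hx.2, hub⟩
    have hcx : c < x := lt_of_le_of_ne hc.1.1.2 (by rintro rfl; exact hxS hc.1.2)
    have hxd : x < d := lt_of_le_of_ne hd.1.1.1 (by rintro rfl; exact hxS hd.1.2)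
    have hac : a ≤ c := hc.1.1.1
    have hdb : d ≤ b := hd.1.1.2
    have hno : ∀ z ∈ Ioo c d, z ∉ S := by
      intro z hz hzS
      rcases le_total z x with h1 | h1
      · have := hc.2 ⟨⟨hac.trans hz.1.le, h1⟩, hzS⟩
        linarith [hz.1]
      · have := hd.2 ⟨⟨h1, hz.2.le.trans hdb⟩, hzS⟩
        linarith [hz.2]
    have hcd : c < d := hcx.trans hxd
    have hder : ∀ z ∈ Ioo c d, HasDerivAt u 0 z := fun z hz =>
      hloc z ⟨hac.trans_lt hz.1, hz.2.trans_le hdb⟩ (hno z hz)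
    obtain ⟨ξ, _, hξ⟩ := exists_hasDerivAt_eq_slope u (fun _ => 0) hcd
      (huc.mono (Icc_subset_Icc hac hdb)) hder
    have hud : u d = u c := by
      have : d - c ≠ 0 := by linarith
      field_simp at hξ
      linarith
    have hvd : v d = v c := by
      have h1 : u d = v d := hd.1.2
      have h2 : u c = v c := hc.1.2
      rw [← h1, ← h2, hud]
    have hcI : c ∈ Icc a b := ⟨hac, by linarith⟩
    have hdI : d ∈ Icc a b := ⟨by linarith, hdb⟩
    have hsubint : ∀ p ∈ Icc a b, ∀ q ∈ Icc a b, IntervalIntegrable v' volume p q := by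
      intro p hp q hq
      apply hv'.mono_set
      rw [uIcc_of_le hab.le]
      exact ordConnected_Icc.uIcc_subset hp hq
    have haI : a ∈ Icc a b := left_mem_Icc.2 hab.le
    have hint0 : ∫ t in c..d, v' t = 0 := by
      rw [← intervalIntegral.integral_interval_sub_left (hsubint a haI d hdI)
        (hsubint a haI c hcI)]
      have h1 := hvrep c hcI
      have h2 := hvrep d hdI
      linarith
    have hcdint := hsubint c hcI d hdI
    have hmem : ∀ p ∈ Ioo c d, p ∈ Icc a b := fun p hp =>
      ⟨hac.trans hp.1.le, hp.2.le.trans hdb⟩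
    obtain ⟨p, hp, hp0⟩ : ∃ p ∈ Ioo c d, v' p ≤ 0 := by
      by_contra hcon
      push Not at hcon
      have := intervalIntegral.intervalIntegral_pos_of_pos_on hcdint hcon hcd
      linarith
    obtain ⟨q, hq, hq0⟩ : ∃ p ∈ Ioo c d, 0 ≤ v' p := by
      by_contra hcon
      push Not at hcon
      have := intervalIntegral.intervalIntegral_pos_of_pos_on hcdint.neg
        (fun t ht => neg_pos.2 (hcon t ht)) hcd
      simp only [Pi.neg_apply, intervalIntegral.integral_neg] at this
      linarith
    exact ⟨p, hmem p hp, q, hmem q hq, hp0, hq0,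
      fun z hz => hno z (ordConnected_Ioo.uIcc_subset ⟨hcx, hxd⟩ hp hz),
      fun z hz => hno z (ordConnected_Ioo.uIcc_subset ⟨hcx, hxd⟩ hq hz)⟩
  let u' : ℝ → ℝ := fun x => if x ∈ S then v' x else 0
  have hvar : eVariationOn u' (Icc a b) ≤ eVariationOn v' (Icc a b) := aux_zero hv'BV hgap
  have hu'BV : BoundedVariationOn u' (Icc a b) := ne_top_of_le_ne_top hv'BV hvar
  have hu'int := aux_bv_int hab.le hu'BV
  have hAC : AbsolutelyContinuousOnInterval u a b :=
    LipschitzOnWith.absolutelyContinuousOnInterval (K := M) (by rwa [uIcc_of_le hab.le])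
  -- a.e. identification of the derivative
  have hae : ∀ᵐ t, t ∈ Icc a b → deriv u t = u' t := by
    have hcnt : ({a, b} ∪ {x ∈ S | nhdsWithin x (S ∩ Ioi x) = ⊥} : Set ℝ).Countable :=
      (Set.toFinite _).countable.union countable_setOfPred_isolated_right_within
    filter_upwards [hAC.ae_differentiableAt, hv'.ae_hasDerivAt_integral,
      hcnt.ae_notMem volume] with t h1 h2 h3 ht
    rw [uIcc_of_le hab.le] at h1 h2
    simp only [mem_union, mem_insert_iff, mem_singleton_iff, not_or] at h3
    have htI : t ∈ Ioo a b :=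
      ⟨lt_of_le_of_ne ht.1 (Ne.symm h3.1.1), lt_of_le_of_ne ht.2 h3.1.2⟩
    by_cases htS : t ∈ S
    · have hdv : HasDerivAt v (v' t) t := by
        have h4 := (h2 ht a (left_mem_Icc.2 hab.le)).const_add (v a)
        refine h4.congr_of_eventuallyEq ?_
        filter_upwards [Icc_mem_nhds htI.1 htI.2] with s hs
        exact hvrep s hs
      have hdu := (h1 ht).hasDerivAt
      have hne : (nhdsWithin t (S ∩ Ioi t)).NeBot := ⟨fun hbot => h3.2 ⟨htS, hbot⟩⟩
      have hsub : S ∩ Ioi t ⊆ {t}ᶜ := fun s hs => (ne_of_gt hs.2)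
      have l1 := (hasDerivAt_iff_tendsto_slope.1 hdu).mono_left (nhdsWithin_mono t hsub)
      have l2 := (hasDerivAt_iff_tendsto_slope.1 hdv).mono_left (nhdsWithin_mono t hsub)
      have l3 : slope u t =ᶠ[nhdsWithin t (S ∩ Ioi t)] slope v t := by
        filter_upwards [self_mem_nhdsWithin] with s hs
        have e1 : u s = v s := hs.1
        have e2 : u t = v t := htS
        rw [slope_def_field, slope_def_field, e1, e2]
      have := tendsto_nhds_unique (l1.congr' l3) l2
      simp only [u', htS, if_true]
      exact this
    · simp only [u', htS, if_false]
      exact (hloc t htI htS).deriv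
  refine ⟨u', hu'int, ?_, hu'BV, ?_⟩
  · intro x hx
    have hACx : AbsolutelyContinuousOnInterval u a x :=
      LipschitzOnWith.absolutelyContinuousOnInterval (K := M) (by
        rw [uIcc_of_le hx.1]
        exact hLip.mono (Icc_subset_Icc le_rfl hx.2))
    have h1 := hACx.integral_deriv_eq_sub
    have h2 : ∫ t in a..x, deriv u t = ∫ t in a..x, u' t := by
      apply intervalIntegral.integral_congr_ae
      filter_upwards [hae] with t ht hmem
      rw [uIoc_of_le hx.1] at hmem
      exact ht ⟨hmem.1.le, hmem.2.trans hx.2⟩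
    linarith
  · have h1 := ENNReal.toReal_mono hv'BV hvar
    have h2 : ∫ x in a..b, |u' x| ≤ ∫ x in a..b, |v' x| := by
      apply intervalIntegral.integral_mono_on hab.le hu'int.abs hv'.abs
      intro x _
      by_cases hxS : x ∈ S
      · simp [u', hxS]
      · simp [u', hxS]
    linarith
end
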